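/- arXiv:2411.00401 — 6 statements merged into one kernel-verified Lean document; each statement's English description precedes it below -/
import Mathlib

section
/- Let N ≥ 1 and H > 0 be real numbers, λ ∈ (0,1), r > 0, s_min ∈ (0,1], α ∈ (0,1), γ ∈ (0,1), ε > 0, and let K ≥ N be a real number. If K ≥ 16·N·H²·λ²·r²/(s_min·(1−α)³·(1+α)·ε²) and K ≥ (16·N·H²/ε²)^{1/(1−γ)}, then 2·√N·H·(λ·r/(1−α))·√((1 − α^{2(K/N − 1)})/(s_min·(1 − α²)))/√K + 2·√N·H/K^{(1−γ)/2} ≤ ε. -/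
open Real

/-- the arithmetic core of the sample-complexity theorem (Theorem 2):
if `K` exceeds the two explicit thresholds, then the PAC-Bayes regularizer term is at most `ε`. -/
theorem stmt2 (N H lam r smin α γ ε K : ℝ)
    (hN : 1 ≤ N) (hH : 0 < H)
    (hlam : lam ∈ Set.Ioo (0:ℝ) 1)
    (hr : 0 < r)
    (hsmin : smin ∈ Set.Ioc (0:ℝ) 1)
    (hα : α ∈ Set.Ioo (0:ℝ) 1)
    (hγ : γ ∈ Set.Ioo (0:ℝ) 1)
    (hε : 0 < ε)
    (hKN : N ≤ K)
    (h1 : 16 * N * H ^ 2 * lam ^ 2 * r ^ 2 / (smin * (1 - α) ^ 3 * (1 + α) * ε ^ 2) ≤ K)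
    (h2 : (16 * N * H ^ 2 / ε ^ 2) ^ ((1 : ℝ) / (1 - γ)) ≤ K) :
    2 * Real.sqrt N * H * (lam * r / (1 - α)) *
        Real.sqrt ((1 - α ^ (2 * (K / N - 1))) / (smin * (1 - α ^ 2))) / Real.sqrt K
      + 2 * Real.sqrt N * H / K ^ ((1 - γ) / 2) ≤ ε := by
  have hsmin0 : 0 < smin := hsmin.1
  have hN0 : 0 < N := by linarith
  have hK0 : 0 < K := by linarith
  have hα0 : 0 < 1 - α := by linarith [hα.2]
  have hα1 : 0 < 1 + α := by linarith [hα.1]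
  have hγ0 : 0 < 1 - γ := by linarith [hγ.2]
  have hsq : 0 < 1 - α ^ 2 := by nlinarith
  have hexp : 0 ≤ 2 * (K / N - 1) := by
    have : 1 ≤ K / N := (one_le_div hN0).2 hKN
    linarith
  have hle : α ^ (2 * (K / N - 1)) ≤ 1 := rpow_le_one hα.1.le hα.2.le hexp
  have hpos : 0 < α ^ (2 * (K / N - 1)) := rpow_pos_of_pos hα.1 _
  have hfirst : 2 * √N * H * (lam * r / (1 - α)) *
      √((1 - α ^ (2 * (K / N - 1))) / (smin * (1 - α ^ 2))) / √K ≤ ε / 2 := by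
    refine le_of_abs_le (abs_le_of_sq_le_sq ?_ (by positivity))
    have hfrac : 0 ≤ (1 - α ^ (2 * (K / N - 1))) / (smin * (1 - α ^ 2)) :=
      div_nonneg (by linarith) (by positivity)
    rw [div_pow, mul_pow, mul_pow, mul_pow, mul_pow, sq_sqrt hN0.le, sq_sqrt hK0.le,
      sq_sqrt hfrac, div_le_iff₀ hK0]
    calc 2 ^ 2 * N * H ^ 2 * (lam * r / (1 - α)) ^ 2 *
          ((1 - α ^ (2 * (K / N - 1))) / (smin * (1 - α ^ 2)))
        ≤ 2 ^ 2 * N * H ^ 2 * (lam * r / (1 - α)) ^ 2 * (1 / (smin * (1 - α ^ 2))) := by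
          gcongr
          linarith
      _ = (ε / 2) ^ 2 * (16 * N * H ^ 2 * lam ^ 2 * r ^ 2 /
            (smin * (1 - α) ^ 3 * (1 + α) * ε ^ 2)) := by
          rw [show 1 - α ^ 2 = (1 - α) * (1 + α) by ring]
          field_simp
          ring
      _ ≤ (ε / 2) ^ 2 * K := by gcongr
  have hsecond : 2 * √N * H / K ^ ((1 - γ) / 2) ≤ ε / 2 := by
    refine le_of_abs_le (abs_le_of_sq_le_sq ?_ (by positivity))
    have hthreshold : 16 * N * H ^ 2 / ε ^ 2 ≤ K ^ (1 - γ) := by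
      rw [one_div] at h2
      exact (rpow_inv_le_iff_of_pos (by positivity) hK0.le hγ0).1 h2
    have hpow : (K ^ ((1 - γ) / 2)) ^ 2 = K ^ (1 - γ) := by
      rw [← rpow_mul_natCast hK0.le]
      congr 1
      push_cast
      ring
    rw [div_le_iff₀ (by positivity)] at hthreshold
    rw [div_pow, mul_pow, mul_pow, sq_sqrt hN0.le, hpow, div_le_iff₀ (rpow_pos_of_pos hK0 _)]
    linarith
  linarith
end

section
/- Let Θ be a nonempty finite set, T ≥ 1 an integer, α ∈ [1/2, 1), λ ∈ (0,1), r ≥ 0, and s_min > 0. Let P₀, …, P_{T−1} be probability mass functions on Θ with TV(P_l, P_{l−1}) ≤ r for all 1 ≤ l ≤ T−1. Define λ_l := α^{l−1}·λ and the prior pmfs by P̄₀ := P₀ and P̄_l := λ_l·P̄_{l−1} + (1−λ_l)·P_l for l ≥ 1, and assume P̄_l(θ) ≥ s_min for every l and every θ ∈ Θ. Then Σ_{l=1}^{T−1} KL(P_l ‖ P̄_l) ≤ (2·λ²·r²/(s_min·(1−α)²)) · (1 − α^{2(T−1)})/(1 − α²). -/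
open Finset

/-- Total variation distance between two functions (pmfs) on a finite type:
`sup_{A ⊆ Θ} |∑_{θ∈A} (p θ − q θ)|`. -/
noncomputable def tvDist {ι : Type*} [Fintype ι] (p q : ι → ℝ) : ℝ :=
  ⨆ A : Finset ι, |∑ i ∈ A, (p i - q i)|

/-- Kullback–Leibler divergence between two pmfs on a finite type:
`∑_θ p θ · log (p θ / q θ)`. -/
noncomputable def klFin {ι : Type*} [Fintype ι] (p q : ι → ℝ) : ℝ :=
  ∑ i, p i * Real.log (p i / q i)

lemma abs_sum_le_tvDist {ι : Type*} [Fintype ι] (p q : ι → ℝ) (A : Finset ι) :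
    |∑ i ∈ A, (p i - q i)| ≤ tvDist p q :=
  le_ciSup (f := fun A : Finset ι => |∑ i ∈ A, (p i - q i)|) (Set.finite_range _).bddAbove A

lemma sum_sq_le_two_mul_sq_of_abs_sum_le {ι : Type*} [Fintype ι] {x : ι → ℝ} {D : ℝ}
    (h : ∀ A : Finset ι, |∑ i ∈ A, x i| ≤ D) : ∑ i, x i ^ 2 ≤ 2 * D ^ 2 := by
  have hD : 0 ≤ D := (abs_nonneg _).trans (h ∅)
  have hx (i : ι) : |x i| ≤ D := by simpa using h {i}
  have hpos : ∑ i with 0 ≤ x i, x i ^ 2 ≤ D ^ 2 := calc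
    _ ≤ ∑ i with 0 ≤ x i, D * x i := by
      refine Finset.sum_le_sum fun i hi => ?_
      nlinarith [(Finset.mem_filter.mp hi).2, (abs_le.mp (hx i)).2]
    _ = D * ∑ i with 0 ≤ x i, x i := by rw [Finset.mul_sum]
    _ ≤ D ^ 2 := by nlinarith [(abs_le.mp (h {i | 0 ≤ x i})).2]
  have hneg : ∑ i with ¬ 0 ≤ x i, x i ^ 2 ≤ D ^ 2 := calc
    _ ≤ ∑ i with ¬ 0 ≤ x i, -D * x i := by
      refine Finset.sum_le_sum fun i hi => ?_
      nlinarith [(Finset.mem_filter.mp hi).2, (abs_le.mp (hx i)).1]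
    _ = -D * ∑ i with ¬ 0 ≤ x i, x i := by rw [Finset.mul_sum]
    _ ≤ D ^ 2 := by nlinarith [(abs_le.mp (h {i | ¬ 0 ≤ x i})).1]
  rw [← Finset.sum_filter_add_sum_filter_not Finset.univ (fun i => 0 ≤ x i)]
  linarith

lemma mul_log_div_le {p q s : ℝ} (hp : 0 ≤ p) (hs : 0 < s) (hq : s ≤ q) :
    p * Real.log (p / q) ≤ (p - q) ^ 2 / s + (p - q) := by
  have hq0 : 0 < q := hs.trans_le hq
  have hlog : p * Real.log (p / q) ≤ p * (p / q - 1) := by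
    rcases hp.eq_or_lt with rfl | hp
    · simp
    · exact mul_le_mul_of_nonneg_left (Real.log_le_sub_one_of_pos (by positivity)) hp.le
  have heq : p * (p / q - 1) = (p - q) ^ 2 / q + (p - q) := by field_simp; ring
  have hle : (p - q) ^ 2 / q ≤ (p - q) ^ 2 / s := by gcongr
  linarith

/-- A reverse Pinsker inequality on a finite type. -/
lemma klFin_le_of_abs_sum_le {ι : Type*} [Fintype ι] {p q : ι → ℝ} {s D : ℝ}
    (hp : ∀ i, 0 ≤ p i) (hs : 0 < s) (hq : ∀ i, s ≤ q i) (hpq : ∑ i, (p i - q i) = 0)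
    (h : ∀ A : Finset ι, |∑ i ∈ A, (p i - q i)| ≤ D) : klFin p q ≤ 2 * D ^ 2 / s := calc
  klFin p q ≤ ∑ i, ((p i - q i) ^ 2 / s + (p i - q i)) :=
    Finset.sum_le_sum fun i _ => mul_log_div_le (hp i) hs (hq i)
  _ = (∑ i, (p i - q i) ^ 2) / s := by rw [Finset.sum_add_distrib, hpq, Finset.sum_div, add_zero]
  _ ≤ 2 * D ^ 2 / s := by gcongr; exact sum_sq_le_two_mul_sq_of_abs_sum_le h

/-- the KL-divergence lemma for the EPIC prior update. With posteriors
`P₀,…,P_{T−1}` satisfying `TV(P_l, P_{l−1}) ≤ r`, mixing weights `λ_l = α^(l−1)·λ` and priors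
`P̄₀ = P₀`, `P̄_l = λ_l·P̄_{l−1} + (1−λ_l)·P_l` bounded below by `s_min`, we have
`∑_{l=1}^{T−1} KL(P_l ‖ P̄_l) ≤ (2λ²r²/(s_min(1−α)²))·(1−α^{2(T−1)})/(1−α²)`. -/
theorem stmt3 {Θ : Type*} [Fintype Θ] [Nonempty Θ]
    (T : ℕ) (hT : 1 ≤ T)
    (α lam r smin : ℝ)
    (hα : α ∈ Set.Ico (1/2 : ℝ) 1)
    (hlam : lam ∈ Set.Ioo (0:ℝ) 1)
    (hr : 0 ≤ r)
    (hsmin : 0 < smin)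
    (P Pbar : ℕ → Θ → ℝ)
    (hpmf : ∀ l, (∀ θ, 0 ≤ P l θ) ∧ ∑ θ, P l θ = 1)
    (htv : ∀ l, 1 ≤ l → l ≤ T - 1 → tvDist (P l) (P (l - 1)) ≤ r)
    (hPbar0 : Pbar 0 = P 0)
    (hPbarS : ∀ m : ℕ, Pbar (m + 1) =
      fun θ => α ^ m * lam * Pbar m θ + (1 - α ^ m * lam) * P (m + 1) θ)
    (hlow : ∀ l θ, smin ≤ Pbar l θ) :
    ∑ l ∈ Finset.Icc 1 (T - 1), klFin (P l) (Pbar l)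
      ≤ (2 * lam ^ 2 * r ^ 2 / (smin * (1 - α) ^ 2)) * (1 - α ^ (2 * (T - 1))) / (1 - α ^ 2) := by
  obtain ⟨hα₁, hα₂⟩ := hα
  obtain ⟨hlam₀, hlam₁⟩ := hlam
  have hα₀ : 0 < α := by linarith
  have h1α : 0 < 1 - α := by linarith
  have hstep (m : ℕ) (A : Finset Θ) : ∑ θ ∈ A, (P (m + 1) θ - Pbar (m + 1) θ) =
      α ^ m * lam * (∑ θ ∈ A, (P (m + 1) θ - P m θ) + ∑ θ ∈ A, (P m θ - Pbar m θ)) := by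
    rw [← Finset.sum_add_distrib, Finset.mul_sum, hPbarS]
    exact Finset.sum_congr rfl fun θ _ => by ring
  have hsum (m : ℕ) : ∑ θ, (P m θ - Pbar m θ) = 0 := by
    induction m with
    | zero => simp [hPbar0]
    | succ m ih => rw [hstep, ih, Finset.sum_sub_distrib, (hpmf _).2, (hpmf _).2]; simp
  have hstep_le {m : ℕ} (hm : m + 1 ≤ T - 1) {D : ℝ} {A : Finset Θ}
      (hD : |∑ θ ∈ A, (P m θ - Pbar m θ)| ≤ D) :
      |∑ θ ∈ A, (P (m + 1) θ - Pbar (m + 1) θ)| ≤ α ^ m * lam * (r + D) := by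
    have hP : |∑ θ ∈ A, (P (m + 1) θ - P m θ)| ≤ r :=
      (abs_sum_le_tvDist _ _ A).trans (htv (m + 1) (by omega) hm)
    rw [hstep, abs_mul, abs_of_nonneg (by positivity : 0 ≤ α ^ m * lam)]
    gcongr
    exact (abs_add_le _ _).trans (add_le_add hP hD)
  have hadd : r + α * r / (1 - α) = r / (1 - α) := by field_simp; ring
  have hbound (m : ℕ) (hm : m ≤ T - 1) (A : Finset Θ) :
      |∑ θ ∈ A, (P m θ - Pbar m θ)| ≤ α * r / (1 - α) := by
    induction m with
    | zero => simp only [hPbar0, sub_self, Finset.sum_const_zero, abs_zero]; positivity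
    | succ m ih =>
      rcases m with _ | m
      · refine (hstep_le hm (D := 0) (by simp [hPbar0])).trans ?_
        rw [le_div_iff₀ h1α]
        have : lam * (1 - α) ≤ α := by nlinarith
        nlinarith
      · refine (hstep_le hm (ih (by omega))).trans ?_
        rw [hadd, mul_div_assoc]
        have : α ^ (m + 1) ≤ α := pow_le_of_le_one hα₀.le hα₂.le (by omega)
        have : α ^ (m + 1) * lam ≤ α := (mul_le_of_le_one_right (by positivity) hlam₁.le).trans this
        gcongr
  have hkl (m : ℕ) (hm : m + 1 ≤ T - 1) : klFin (P (m + 1)) (Pbar (m + 1)) ≤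
      2 * (α ^ m * lam * (r / (1 - α))) ^ 2 / smin :=
    klFin_le_of_abs_sum_le (hpmf _).1 hsmin (hlow _) (hsum _) fun A => by
      simpa only [hadd] using hstep_le hm (hbound m (by omega) A)
  have h1α2 : 1 - α ^ 2 ≠ 0 := by nlinarith
  have hpartial (n : ℕ) (hn : n ≤ T - 1) : ∑ l ∈ Finset.Icc 1 n, klFin (P l) (Pbar l) ≤
      (2 * lam ^ 2 * r ^ 2 / (smin * (1 - α) ^ 2)) * (1 - α ^ (2 * n)) / (1 - α ^ 2) := by
    induction n with
    | zero => simp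
    | succ n ih =>
      rw [Finset.sum_Icc_succ_top (by omega)]
      refine (add_le_add (ih (by omega)) (hkl n hn)).trans_eq ?_
      field_simp
      ring
  exact hpartial (T - 1) le_rfl
end

section
/- Let V be a real normed vector space, α ∈ [1/2, 1), λ ∈ (0,1), and r ≥ 0. Let (P_l)_{l≥0} be a sequence in V with ‖P_l − P_{l−1}‖ ≤ r for every l ≥ 1. Define λ_l := α^{l−1}·λ and the sequence P̄₀ := P₀, P̄_l := λ_l·P̄_{l−1} + (1−λ_l)·P_l for l ≥ 1. Then for every l ≥ 1, ‖P_l − P̄_l‖ ≤ λ·r·α^{l−1}/(1−α). -/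
/-- the telescoping estimate for the EPIC prior update in a normed vector space.
With `λ_l = α^(l-1)·λ` and `P̄_l = λ_l • P̄_(l-1) + (1-λ_l) • P_l`, consecutive increments of
size at most `r` yield `‖P_l − P̄_l‖ ≤ λ·r·α^(l-1)/(1-α)` for all `l ≥ 1`.
(Here `l ≥ 1` is encoded by writing `l` as `m + 1` with `m : ℕ`, so `α^(l-1) = α^m`.) -/
theorem stmt4 {V : Type*} [NormedAddCommGroup V] [NormedSpace ℝ V]
    (α lam r : ℝ)
    (hα : α ∈ Set.Ico (1/2 : ℝ) 1)
    (hlam : lam ∈ Set.Ioo (0:ℝ) 1)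
    (hr : 0 ≤ r)
    (P Pbar : ℕ → V)
    (hP : ∀ m : ℕ, ‖P (m + 1) - P m‖ ≤ r)
    (hPbar0 : Pbar 0 = P 0)
    (hPbarS : ∀ m : ℕ, Pbar (m + 1) =
      (α ^ m * lam) • Pbar m + (1 - α ^ m * lam) • P (m + 1)) :
    ∀ m : ℕ, ‖P (m + 1) - Pbar (m + 1)‖ ≤ lam * r * α ^ m / (1 - α) := by
  obtain ⟨hα₁, hα₂⟩ := hα
  obtain ⟨hl₁, hl₂⟩ := hlam
  have hα₀ : 0 < α := by linarith
  have hc : ∀ m : ℕ, 0 ≤ α ^ m * lam := fun m => by positivity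
  have step : ∀ m : ℕ, ‖P (m + 1) - Pbar (m + 1)‖ ≤ α ^ m * lam * (r + ‖P m - Pbar m‖) := by
    intro m
    have h : P (m + 1) - Pbar (m + 1) =
        (α ^ m * lam) • ((P (m + 1) - P m) + (P m - Pbar m)) := by
      rw [hPbarS m]
      module
    rw [h, norm_smul, Real.norm_of_nonneg (hc m)]
    exact mul_le_mul_of_nonneg_left
      ((norm_add_le _ _).trans (add_le_add (hP m) le_rfl)) (hc m)
  have bound : ∀ m : ℕ, ‖P m - Pbar m‖ * (1 - α) ≤ r * α := by
    intro m
    induction m with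
    | zero =>
      rw [hPbar0, sub_self, norm_zero, zero_mul]
      positivity
    | succ k ih =>
      have hk := step k
      rcases k with _ | k
      · rw [hPbar0, sub_self, norm_zero, pow_zero, one_mul, add_zero] at hk
        have hle : ‖P (0 + 1) - Pbar (0 + 1)‖ ≤ r := hk.trans (by nlinarith)
        nlinarith
      · have hpow : α ^ (k + 1) * lam ≤ α := by
          have hle : α ^ (k + 1) ≤ α := pow_le_of_le_one hα₀.le hα₂.le k.succ_ne_zero
          nlinarith
        calc ‖P (k + 1 + 1) - Pbar (k + 1 + 1)‖ * (1 - α)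
            ≤ α ^ (k + 1) * lam * (r + ‖P (k + 1) - Pbar (k + 1)‖) * (1 - α) :=
              mul_le_mul_of_nonneg_right hk (by linarith)
          _ = α ^ (k + 1) * lam * ((r + ‖P (k + 1) - Pbar (k + 1)‖) * (1 - α)) := by ring
          _ ≤ α ^ (k + 1) * lam * r :=
              mul_le_mul_of_nonneg_left (by linarith) (hc _)
          _ ≤ α * r := mul_le_mul_of_nonneg_right hpow hr
          _ = r * α := mul_comm _ _
  intro m
  rw [le_div_iff₀ (by linarith)]
  calc ‖P (m + 1) - Pbar (m + 1)‖ * (1 - α)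
      ≤ α ^ m * lam * (r + ‖P m - Pbar m‖) * (1 - α) :=
        mul_le_mul_of_nonneg_right (step m) (by linarith)
    _ = α ^ m * lam * ((r + ‖P m - Pbar m‖) * (1 - α)) := by ring
    _ ≤ α ^ m * lam * r := mul_le_mul_of_nonneg_left (by linarith [bound m]) (hc m)
    _ = lam * r * α ^ m := by ring
end

section
/- Let (Ω, 𝓐, μ) be a probability space with a filtration 𝓕₀ ⊆ 𝓕₁ ⊆ … ⊆ 𝓕_T, and let D₁, …, D_T be a martingale difference sequence with respect to (𝓕_l) such that |D_l| ≤ b almost surely for a constant b > 0. Set S_T := Σ_{l=1}^T D_l and S̃_T := Σ_{l=1}^T E[D_l² ∣ 𝓕_{l−1}]. Then for every λ ∈ [0, 1/b], E[ exp(λ·S_T − λ²·S̃_T) ] ≤ 1. -/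
open MeasureTheory Finset

/-- One step of Freedman's argument: multiplying a bounded nonnegative `m`-measurable weight by
`exp (X - E[X² | m])`, with `X` conditionally centred and `|X| ≤ 1`, does not increase the mean. -/
theorem integral_mul_exp_sub_condExp_sq_le {Ω : Type*} {m mΩ : MeasurableSpace Ω} {μ : Measure Ω}
    [IsFiniteMeasure μ] (hm : m ≤ mΩ) {W X : Ω → ℝ} {C : ℝ}
    (hW : StronglyMeasurable[m] W) (hW0 : ∀ ω, 0 ≤ W ω) (hWC : ∀ᵐ ω ∂μ, W ω ≤ C)
    (hX : Integrable X μ) (hX0 : μ[X | m] =ᵐ[μ] 0) (hX1 : ∀ᵐ ω ∂μ, |X ω| ≤ 1) :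
    ∫ ω, W ω * Real.exp (X ω - (μ[fun ω' => X ω' ^ 2 | m]) ω) ∂μ ≤ ∫ ω, W ω ∂μ := by
  set V : Ω → ℝ := μ[fun ω' => X ω' ^ 2 | m] with hV
  have hV0 : ∀ᵐ ω ∂μ, 0 ≤ V ω := condExp_nonneg (ae_of_all _ fun ω => sq_nonneg (X ω))
  have hVm : StronglyMeasurable[m] V := stronglyMeasurable_condExp
  have hX2 : Integrable (fun ω => X ω ^ 2) μ := by
    refine Integrable.of_bound (hX.aestronglyMeasurable.pow 2) 1 ?_
    filter_upwards [hX1] with ω h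
    rw [Real.norm_eq_abs, abs_pow]
    exact pow_le_one₀ (abs_nonneg _) h
  set G : Ω → ℝ := fun ω => W ω * Real.exp (-V ω) with hG
  have hGm : StronglyMeasurable[m] G :=
    hW.mul (Real.continuous_exp.comp_stronglyMeasurable hVm.neg)
  have hG0 : ∀ ω, 0 ≤ G ω := fun ω => mul_nonneg (hW0 ω) (Real.exp_pos _).le
  have hGW : ∀ᵐ ω ∂μ, G ω ≤ W ω := by
    filter_upwards [hV0] with ω h
    exact mul_le_of_le_one_right (hW0 ω) (Real.exp_le_one_iff.2 (by linarith))
  have hGC : ∀ᵐ ω ∂μ, ‖G ω‖ ≤ C := by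
    filter_upwards [hGW, hWC] with ω h h'
    rw [Real.norm_of_nonneg (hG0 ω)]
    exact h.trans h'
  have hGm' : AEStronglyMeasurable G μ := (hGm.mono hm).aestronglyMeasurable
  have hWi : Integrable W μ := by
    refine Integrable.of_bound (hW.mono hm).aestronglyMeasurable C ?_
    filter_upwards [hWC] with ω h
    rwa [Real.norm_of_nonneg (hW0 ω)]
  set Y : Ω → ℝ := (fun _ => 1) + X + fun ω => X ω ^ 2 with hY
  have hYi : Integrable Y μ := ((integrable_const 1).add hX).add hX2
  have hGY : Integrable (G * Y) μ := hYi.bdd_mul hGm' hGC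
  have hYc : μ[Y | m] =ᵐ[μ] fun ω => 1 + V ω := by
    filter_upwards [condExp_add ((integrable_const (1 : ℝ)).add hX) hX2 m,
      condExp_add (integrable_const (1 : ℝ)) hX m, hX0] with ω h₁ h₂ h₃
    rw [hY, h₁, Pi.add_apply, h₂, Pi.add_apply, h₃, condExp_const hm]
    simp [hV]
  have hGYc : μ[G * Y | m] =ᵐ[μ] fun ω => G ω * (1 + V ω) := by
    filter_upwards [condExp_mul_of_stronglyMeasurable_left hGm hGY hYi, hYc] with ω h₁ h₂
    rw [h₁, Pi.mul_apply, h₂]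
  calc ∫ ω, W ω * Real.exp (X ω - V ω) ∂μ ≤ ∫ ω, (G * Y) ω ∂μ := by
        refine integral_mono_of_nonneg
          (ae_of_all _ fun ω => mul_nonneg (hW0 ω) (Real.exp_pos _).le) hGY ?_
        filter_upwards [hX1] with ω h
        have h₁ := (abs_le.1 (Real.abs_exp_sub_one_sub_id_le h)).2
        have h₂ : W ω * Real.exp (X ω - V ω) = G ω * Real.exp (X ω) := by
          rw [hG, mul_assoc, ← Real.exp_add]
          ring_nf
        rw [h₂]
        refine mul_le_mul_of_nonneg_left ?_ (hG0 ω)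
        simp only [hY, Pi.add_apply]
        linarith
    _ = ∫ ω, (μ[G * Y | m]) ω ∂μ := (integral_condExp hm).symm
    _ ≤ ∫ ω, W ω ∂μ := by
        refine integral_mono_ae integrable_condExp hWi ?_
        filter_upwards [hGYc] with ω h
        rw [h]
        have h₁ : W ω = G ω * Real.exp (V ω) := by
          rw [hG, mul_assoc, ← Real.exp_add]
          simp
        rw [h₁]
        refine mul_le_mul_of_nonneg_left ?_ (hG0 ω)
        linarith [Real.add_one_le_exp (V ω)]

/-- Freedman's exponential supermartingale inequality. For a martingale
difference sequence with `|D_l| ≤ b` a.s., with `S_T = ∑ D_l` and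
`S̃_T = ∑ E[D_l² | 𝓕_{l−1}]`, for every `λ ∈ [0, 1/b]`: `E[exp(λ·S_T − λ²·S̃_T)] ≤ 1`. -/
theorem stmt9 {Ω : Type*} {mΩ : MeasurableSpace Ω} (μ : Measure Ω) [IsProbabilityMeasure μ]
    (T : ℕ) (𝓕 : Filtration ℕ mΩ) (D : ℕ → Ω → ℝ) (b : ℝ) (hb : 0 < b)
    (hadp : ∀ l ∈ Finset.Icc 1 T, StronglyMeasurable[𝓕 l] (D l))
    (hint : ∀ l ∈ Finset.Icc 1 T, Integrable (D l) μ)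
    (hmds : ∀ l ∈ Finset.Icc 1 T, μ[D l | 𝓕 (l - 1)] =ᵐ[μ] 0)
    (hbdd : ∀ l ∈ Finset.Icc 1 T, ∀ᵐ ω ∂μ, |D l ω| ≤ b)
    (lam : ℝ) (hlam : lam ∈ Set.Icc (0:ℝ) (1 / b)) :
    ∫ ω, Real.exp (lam * ∑ l ∈ Finset.Icc 1 T, D l ω -
        lam ^ 2 * ∑ l ∈ Finset.Icc 1 T, (μ[fun ω' => (D l ω') ^ 2 | 𝓕 (l - 1)]) ω) ∂μ ≤ 1 := by
  set Z : ℕ → Ω → ℝ := fun n ω => Real.exp (lam * ∑ l ∈ Finset.Icc 1 n, D l ω -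
    lam ^ 2 * ∑ l ∈ Finset.Icc 1 n, (μ[fun ω' => (D l ω') ^ 2 | 𝓕 (l - 1)]) ω) with hZ
  suffices H : ∀ n ≤ T, StronglyMeasurable[𝓕 n] (Z n) ∧ (∃ C, ∀ᵐ ω ∂μ, Z n ω ≤ C) ∧
      ∫ ω, Z n ω ∂μ ≤ 1 from (H T le_rfl).2.2
  intro n
  induction n with
  | zero =>
    intro _
    have h0 : Z 0 = fun _ => 1 := by
      funext ω
      simp [hZ]
    rw [h0]
    exact ⟨stronglyMeasurable_const, ⟨1, ae_of_all _ fun _ => le_rfl⟩, by simp⟩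
  | succ n ih =>
    intro hn
    obtain ⟨hZm, ⟨C, hC⟩, hZ1⟩ := ih (by omega)
    have hmem : n + 1 ∈ Finset.Icc 1 T := Finset.mem_Icc.2 ⟨by omega, hn⟩
    have hDm := hadp _ hmem
    have hDi := hint _ hmem
    have hD0 := hmds _ hmem
    have hDb := hbdd _ hmem
    rw [Nat.add_sub_cancel] at hD0
    set V : Ω → ℝ := μ[fun ω' => D (n + 1) ω' ^ 2 | 𝓕 n] with hV
    have hVm : StronglyMeasurable[𝓕 n] V := stronglyMeasurable_condExp
    have hV0 : ∀ᵐ ω ∂μ, 0 ≤ V ω :=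
      condExp_nonneg (ae_of_all _ fun ω => sq_nonneg (D (n + 1) ω))
    have hsucc : Z (n + 1) = fun ω =>
        Z n ω * Real.exp (lam * D (n + 1) ω - lam ^ 2 * V ω) := by
      funext ω
      simp only [hZ, hV]
      rw [Finset.sum_Icc_succ_top (by omega), Finset.sum_Icc_succ_top (by omega), ← Real.exp_add,
        Nat.add_sub_cancel]
      ring_nf
    have hX1 : ∀ᵐ ω ∂μ, |lam * D (n + 1) ω| ≤ 1 := by
      filter_upwards [hDb] with ω h
      rw [abs_mul, abs_of_nonneg hlam.1]
      calc lam * |D (n + 1) ω| ≤ 1 / b * b :=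
            mul_le_mul hlam.2 h (abs_nonneg _) (by positivity)
        _ = 1 := one_div_mul_cancel hb.ne'
    have hX0 : μ[fun ω => lam * D (n + 1) ω | 𝓕 n] =ᵐ[μ] 0 := by
      filter_upwards [condExp_smul (μ := μ) lam (D (n + 1)) (𝓕 n), hD0] with ω h₁ h₂
      refine h₁.trans ?_
      simp [h₂]
    have hX2 : μ[fun ω => (lam * D (n + 1) ω) ^ 2 | 𝓕 n] =ᵐ[μ] fun ω => lam ^ 2 * V ω := by
      simp only [mul_pow]
      exact condExp_smul (μ := μ) (lam ^ 2) (fun ω => D (n + 1) ω ^ 2) (𝓕 n)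
    have hstep := integral_mul_exp_sub_condExp_sq_le (𝓕.le n) hZm
      (fun ω => (Real.exp_pos _).le) hC (hDi.const_mul lam) hX0 hX1
    rw [hsucc]
    refine ⟨?_, ⟨C * Real.exp 1, ?_⟩, ?_⟩
    · have hle : 𝓕 n ≤ 𝓕 (n + 1) := 𝓕.mono n.le_succ
      exact (hZm.mono hle).mul (Real.continuous_exp.comp_stronglyMeasurable
        ((hDm.const_mul lam).sub ((hVm.mono hle).const_mul (lam ^ 2))))
    · filter_upwards [hC, hX1, hV0] with ω h₁ h₂ h₃
      have h₄ : 0 ≤ lam ^ 2 * V ω := by positivity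
      have h₅ : 0 ≤ Z n ω := (Real.exp_pos _).le
      exact mul_le_mul h₁ (Real.exp_le_exp.2 (by linarith [(abs_le.1 h₂).2]))
        (Real.exp_pos _).le (h₅.trans h₁)
    · refine le_trans (le_of_eq (integral_congr_ae ?_)) (hstep.trans hZ1)
      filter_upwards [hX2] with ω h
      rw [h]
end

section
/- Let (Ω, 𝓐, μ) be a probability space, 𝓖 ⊆ 𝓐 a sub-σ-algebra, and X an integrable real random variable with |X| ≤ b almost surely for a constant b > 0 and E[X ∣ 𝓖] = 0 almost surely. Then for every λ ∈ [0, 1/b], E[ exp(λ·X) ∣ 𝓖 ] ≤ exp( λ²·E[X² ∣ 𝓖] ) almost surely. -/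
open MeasureTheory

/-- one-step conditional moment-generating-function bound. If `|X| ≤ b` a.s.
and `E[X | 𝓖] = 0` a.s., then for every `λ ∈ [0, 1/b]`,
`E[exp(λ·X) | 𝓖] ≤ exp(λ²·E[X² | 𝓖])` almost surely. -/
theorem stmt10 {Ω : Type*} {mΩ : MeasurableSpace Ω} (μ : Measure Ω) [IsProbabilityMeasure μ]
    (𝓖 : MeasurableSpace Ω) (h𝓖 : 𝓖 ≤ mΩ)
    (X : Ω → ℝ) (hX : Integrable X μ)
    (b : ℝ) (hb : 0 < b)
    (hbdd : ∀ᵐ ω ∂μ, |X ω| ≤ b)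
    (hcond : μ[X | 𝓖] =ᵐ[μ] 0)
    (lam : ℝ) (hlam : lam ∈ Set.Icc (0:ℝ) (1 / b)) :
    ∀ᵐ ω ∂μ, (μ[fun ω' => Real.exp (lam * X ω') | 𝓖]) ω
      ≤ Real.exp (lam ^ 2 * (μ[fun ω' => (X ω') ^ 2 | 𝓖]) ω) := by
  have hlam0 : 0 ≤ lam := hlam.1
  have hlamX : ∀ᵐ ω ∂μ, |lam * X ω| ≤ 1 := by
    filter_upwards [hbdd] with ω hω
    rw [abs_mul, abs_of_nonneg hlam0]
    calc lam * |X ω| ≤ 1 / b * b := by gcongr; exact hlam.2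
      _ = 1 := by field_simp
  have hexp : Integrable (fun ω => Real.exp (lam * X ω)) μ := by
    refine Integrable.of_bound
      (Real.continuous_exp.comp_aestronglyMeasurable (hX.aestronglyMeasurable.const_mul lam))
      (Real.exp 1) ?_
    filter_upwards [hlamX] with ω hω
    rw [Real.norm_eq_abs, Real.abs_exp]
    exact Real.exp_le_exp.2 (le_of_abs_le hω)
  have hsq : Integrable (fun ω => X ω ^ 2) μ := by
    refine Integrable.of_bound (hX.aestronglyMeasurable.pow 2) (b ^ 2) ?_
    filter_upwards [hbdd] with ω hω
    rw [norm_pow, Real.norm_eq_abs]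
    gcongr
  have hlin : Integrable ((fun _ => (1 : ℝ)) + lam • X) μ :=
    (integrable_const 1).add (hX.smul lam)
  have hquad : Integrable (lam ^ 2 • fun ω => X ω ^ 2) μ := hsq.smul (lam ^ 2)
  have hle : (fun ω => Real.exp (lam * X ω)) ≤ᵐ[μ]
      (fun _ => (1 : ℝ)) + lam • X + lam ^ 2 • fun ω => X ω ^ 2 := by
    filter_upwards [hlamX] with ω hω
    have h := le_of_abs_le (Real.abs_exp_sub_one_sub_id_le hω)
    simp only [Pi.add_apply, Pi.smul_apply, smul_eq_mul]
    linarith [mul_pow lam (X ω) 2]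
  filter_upwards [condExp_mono (m := 𝓖) hexp (hlin.add hquad) hle, condExp_add hlin hquad 𝓖,
    condExp_add (integrable_const (1 : ℝ)) (hX.smul lam) 𝓖, condExp_smul (μ := μ) lam X 𝓖,
    condExp_smul (μ := μ) (lam ^ 2) (fun ω => X ω ^ 2) 𝓖, hcond] with ω h₁ h₂ h₃ h₄ h₅ h₆
  rw [condExp_const h𝓖] at h₃
  simp only [Pi.add_apply, Pi.smul_apply, smul_eq_mul, Pi.zero_apply] at h₂ h₃ h₄ h₅ h₆
  rw [h₆, mul_zero] at h₄
  rw [h₂, h₃, h₄, h₅] at h₁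
  linarith [Real.add_one_le_exp (lam ^ 2 * (μ[fun ω' => X ω' ^ 2 | 𝓖]) ω)]
end

section
/- Let (Ω, 𝓐, μ) be a probability space with a filtration 𝓕₀ ⊆ 𝓕₁ ⊆ … ⊆ 𝓕_T, Θ a measurable space, and D : {1,…,T} × Ω × Θ → ℝ jointly measurable such that for each fixed θ ∈ Θ the sequence (D_l(·, θ))_{l=1}^T is a martingale difference sequence with respect to (𝓕_l) satisfying |D_l(ω, θ)| ≤ c almost surely for a constant c > 0. Write S_T(ω, θ) := Σ_{l=1}^T D_l(ω, θ), and let P̄ be a probability measure on Θ. Then for every λ > 0 and every δ ∈ (0,1), with μ-probability at least 1 − δ, simultaneously for every probability measure P on Θ with KL(P‖P̄) finite, |∫_Θ S_T(ω, θ) dP(θ)| ≤ (KL(P‖P̄) + log(2/δ))/λ + λ·T·c²/2. -/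
open MeasureTheory ENNReal Classical Finset

/-- Kullback–Leibler divergence between measures: `∫ log(dP/dP̄) dP` when `P ≪ P̄` and the
log-likelihood ratio is `P`-integrable, and `+∞` otherwise. -/
noncomputable def klDiv {α : Type*} [MeasurableSpace α] (P Q : Measure α) : ℝ≥0∞ :=
  if P ≪ Q ∧ Integrable (llr P Q) P then ENNReal.ofReal (∫ x, llr P Q x ∂P) else ⊤

/-- One half of the **Donsker–Varadhan variational formula**, for essentially bounded functions. -/
theorem integral_le_klDiv_add_log_integral_exp {α : Type*} [MeasurableSpace α] {P Q : Measure α}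
    [IsProbabilityMeasure P] [IsProbabilityMeasure Q] {f : α → ℝ} (hf : Measurable f) {K : ℝ}
    (hK : ∀ᵐ x ∂Q, |f x| ≤ K) (hkl : klDiv P Q ≠ ⊤) :
    ∫ x, f x ∂P ≤ (klDiv P Q).toReal + Real.log (∫ x, Real.exp (f x) ∂Q) := by
  have h : P ≪ Q ∧ Integrable (llr P Q) P := by
    by_contra h
    exact hkl (if_neg h)
  have hfP : Integrable f P := Integrable.of_bound hf.aestronglyMeasurable K (h.1.ae_le hK)
  have hfQ : Integrable (fun x => Real.exp (f x)) Q := by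
    refine Integrable.of_bound hf.exp.aestronglyMeasurable (Real.exp K) ?_
    filter_upwards [hK] with x hx
    rw [Real.norm_eq_abs, Real.abs_exp]
    exact Real.exp_le_exp.2 ((le_abs_self _).trans hx)
  have := isProbabilityMeasure_tilted hfQ
  have hnonneg := InformationTheory.integral_llr_add_sub_measure_univ_nonneg
    (h.1.trans (absolutelyContinuous_tilted hfQ)) (integrable_llr_tilted_right h.1 hfP h.2 hfQ)
  rw [integral_llr_tilted_right h.1 hfP hfQ h.2] at hnonneg
  have hle : ∫ x, llr P Q x ∂P ≤ (klDiv P Q).toReal := by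
    rw [klDiv, if_pos h, ENNReal.toReal_ofReal']
    exact le_max_left _ _
  simp only [probReal_univ] at hnonneg
  linarith

/-- **Azuma–Hoeffding**: the exponential moment bound for sums of bounded martingale
differences. -/
theorem integral_exp_mul_sum_le_of_martingale_diff {Ω : Type*} {mΩ : MeasurableSpace Ω}
    {μ : Measure Ω} [IsProbabilityMeasure μ] {𝓕 : Filtration ℕ mΩ} {X : ℕ → Ω → ℝ} {c : ℝ}
    (hc : 0 < c) (n : ℕ)
    (hadp : ∀ l ∈ Finset.Icc 1 n, StronglyMeasurable[𝓕 l] (X l))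
    (hmds : ∀ l ∈ Finset.Icc 1 n, μ[X l | 𝓕 (l - 1)] =ᵐ[μ] 0)
    (hbdd : ∀ l ∈ Finset.Icc 1 n, ∀ᵐ ω ∂μ, |X l ω| ≤ c) (t : ℝ) :
    Integrable (fun ω => Real.exp (t * ∑ l ∈ Finset.Icc 1 n, X l ω)) μ ∧
      ∫ ω, Real.exp (t * ∑ l ∈ Finset.Icc 1 n, X l ω) ∂μ ≤ Real.exp (n * ((t * c) ^ 2 / 2)) := by
  induction n with
  | zero => simp
  | succ n ih =>
    have hsub : Finset.Icc 1 n ⊆ Finset.Icc 1 (n + 1) := Finset.Icc_subset_Icc_right n.le_succ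
    have hmem : n + 1 ∈ Finset.Icc 1 (n + 1) := by simp
    obtain ⟨hi, hle⟩ := ih (fun l hl => hadp l (hsub hl)) (fun l hl => hmds l (hsub hl))
      (fun l hl => hbdd l (hsub hl))
    set Y : Ω → ℝ := fun ω => Real.exp (t * ∑ l ∈ Finset.Icc 1 n, X l ω) with hY
    have hYm : StronglyMeasurable[𝓕 n] Y :=
      Real.continuous_exp.comp_stronglyMeasurable
        ((Finset.stronglyMeasurable_fun_sum _ fun l hl =>
          (hadp l (hsub hl)).mono (𝓕.mono (Finset.mem_Icc.1 hl).2)).const_mul t)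
    have hXm : StronglyMeasurable (X (n + 1)) := (hadp _ hmem).mono (𝓕.le _)
    have hXi : Integrable (X (n + 1)) μ :=
      Integrable.of_bound hXm.aestronglyMeasurable c (hbdd _ hmem)
    have hYX : Integrable (Y * X (n + 1)) μ :=
      hi.mul_bdd hXm.aestronglyMeasurable (hbdd _ hmem)
    have hzero : ∫ ω, (Y * X (n + 1)) ω ∂μ = 0 := by
      rw [← integral_condExp (𝓕.le n)]
      refine integral_eq_zero_of_ae ?_
      filter_upwards [condExp_mul_of_stronglyMeasurable_left hYm hYX hXi, hmds _ hmem]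
        with ω h₁ h₂
      rw [h₁, Pi.mul_apply]
      simp only [Nat.add_sub_cancel] at h₂
      simp [h₂]
    have hstep : ∀ ω, Real.exp (t * ∑ l ∈ Finset.Icc 1 (n + 1), X l ω)
        = Y ω * Real.exp (t * X (n + 1) ω) := fun ω => by
      rw [Finset.sum_Icc_succ_top (by omega), mul_add, Real.exp_add]
    have hbound : ∀ᵐ ω ∂μ, Real.exp (t * ∑ l ∈ Finset.Icc 1 (n + 1), X l ω)
        ≤ Real.cosh (t * c) * Y ω + Real.sinh (t * c) / c * (Y * X (n + 1)) ω := by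
      filter_upwards [hbdd _ hmem] with ω hω
      have h₁ : |X (n + 1) ω / c| ≤ 1 := by
        rwa [abs_div, abs_of_pos hc, div_le_one hc]
      have h₂ := Real.exp_mul_le_cosh_add_mul_sinh h₁ (t * c)
      have h₃ : X (n + 1) ω / c * (t * c) = t * X (n + 1) ω := by field_simp
      simp only [h₃] at h₂
      rw [hstep]
      refine (mul_le_mul_of_nonneg_left h₂ (Real.exp_pos _).le).trans_eq ?_
      simp only [Pi.mul_apply, hY]
      ring
    have hri : Integrable (fun ω => Real.cosh (t * c) * Y ω
        + Real.sinh (t * c) / c * (Y * X (n + 1)) ω) μ :=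
      (hi.const_mul _).add (hYX.const_mul _)
    have hint : Integrable (fun ω => Real.exp (t * ∑ l ∈ Finset.Icc 1 (n + 1), X l ω)) μ := by
      refine hri.mono' ?_ ?_
      · simp only [hstep]
        exact ((hYm.mono (𝓕.le n)).mul
          (Real.continuous_exp.comp_stronglyMeasurable (hXm.const_mul t))).aestronglyMeasurable
      · filter_upwards [hbound] with ω hω
        rwa [Real.norm_eq_abs, Real.abs_exp]
    refine ⟨hint, (integral_mono_ae hint hri hbound).trans ?_⟩
    rw [integral_add (hi.const_mul _) (hYX.const_mul _), integral_const_mul, integral_const_mul,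
      hzero, mul_zero, add_zero]
    calc Real.cosh (t * c) * ∫ ω, Y ω ∂μ
        ≤ Real.exp ((t * c) ^ 2 / 2) * Real.exp (n * ((t * c) ^ 2 / 2)) :=
          mul_le_mul (Real.cosh_le_exp_half_sq _) hle
            (integral_nonneg fun _ => (Real.exp_pos _).le) (Real.exp_pos _).le
      _ = Real.exp ((n + 1 : ℕ) * ((t * c) ^ 2 / 2)) := by
          rw [← Real.exp_add]
          push_cast
          ring_nf

/-- uniform control of all posterior distributions (Azuma–Hoeffding variant).
For a family `D_l(·,θ)` of martingale difference sequences bounded by `c` and a prior `P̄`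
on `Θ`, for every `λ > 0` and `δ ∈ (0,1)`, with `μ`-probability at least `1 − δ`,
simultaneously for every probability measure `P` with `KL(P‖P̄) < ∞`:
`|∫ S_T(ω,θ) dP(θ)| ≤ (KL(P‖P̄) + log(2/δ))/λ + λ·T·c²/2`. -/
theorem stmt13 {Ω : Type*} {mΩ : MeasurableSpace Ω} (μ : Measure Ω) [IsProbabilityMeasure μ]
    {Θ : Type*} [MeasurableSpace Θ]
    (T : ℕ) (𝓕 : Filtration ℕ mΩ)
    (D : ℕ → Ω → Θ → ℝ) (c : ℝ) (hc : 0 < c)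
    (hjm : ∀ l ∈ Finset.Icc 1 T, Measurable (fun p : Ω × Θ => D l p.1 p.2))
    (hadp : ∀ l ∈ Finset.Icc 1 T, ∀ θ, StronglyMeasurable[𝓕 l] (fun ω => D l ω θ))
    (hint : ∀ l ∈ Finset.Icc 1 T, ∀ θ, Integrable (fun ω => D l ω θ) μ)
    (hmds : ∀ l ∈ Finset.Icc 1 T, ∀ θ, μ[fun ω => D l ω θ | 𝓕 (l - 1)] =ᵐ[μ] 0)
    (hbdd : ∀ l ∈ Finset.Icc 1 T, ∀ θ, ∀ᵐ ω ∂μ, |D l ω θ| ≤ c)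
    (Pbar : Measure Θ) [IsProbabilityMeasure Pbar]
    (lam : ℝ) (hlam : 0 < lam)
    (δ : ℝ) (hδ : δ ∈ Set.Ioo (0:ℝ) 1) :
    (1 : ℝ≥0∞) - ENNReal.ofReal δ ≤
      μ {ω | ∀ P : Measure Θ, IsProbabilityMeasure P → klDiv P Pbar ≠ ⊤ →
          |∫ θ, (∑ l ∈ Finset.Icc 1 T, D l ω θ) ∂P|
            ≤ ((klDiv P Pbar).toReal + Real.log (2 / δ)) / lam + lam * T * c ^ 2 / 2} := by
  obtain ⟨hδ0, hδ1⟩ := hδ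
  set S : Ω → Θ → ℝ := fun ω θ => ∑ l ∈ Finset.Icc 1 T, D l ω θ with hS
  have hSm : Measurable (fun p : Ω × Θ => S p.1 p.2) := Finset.measurable_fun_sum _ hjm
  set E : ℝ := Real.exp (T * ((lam * c) ^ 2 / 2)) with hE
  have hEpos : 0 < E := Real.exp_pos _
  have hmgf : ∀ t : ℝ, t ^ 2 = lam ^ 2 → ∀ θ,
      ∫⁻ ω, ENNReal.ofReal (Real.exp (t * S ω θ)) ∂μ ≤ ENNReal.ofReal E := by
    intro t ht θ
    obtain ⟨hi, hle⟩ := integral_exp_mul_sum_le_of_martingale_diff (μ := μ) (𝓕 := 𝓕)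
      (X := fun l ω => D l ω θ) hc T (fun l hl => hadp l hl θ) (fun l hl => hmds l hl θ)
      (fun l hl => hbdd l hl θ) t
    rw [← ofReal_integral_eq_lintegral_ofReal hi (ae_of_all _ fun _ => (Real.exp_pos _).le)]
    refine ENNReal.ofReal_le_ofReal (hle.trans_eq ?_)
    rw [hE, mul_pow, mul_pow, ht]
  have hem : ∀ t : ℝ, Measurable
      (fun p : Ω × Θ => ENNReal.ofReal (Real.exp (t * S p.1 p.2))) := fun t =>
    (hSm.const_mul t).exp.ennreal_ofReal
  have hWle : ∀ t : ℝ, t ^ 2 = lam ^ 2 →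
      ∫⁻ ω, ∫⁻ θ, ENNReal.ofReal (Real.exp (t * S ω θ)) ∂Pbar ∂μ ≤ ENNReal.ofReal E := by
    intro t ht
    rw [lintegral_lintegral_swap (hem t).aemeasurable]
    exact (lintegral_mono (hmgf t ht)).trans (by simp)
  have hZm : ∀ t : ℝ, Measurable
      fun ω => ∫⁻ θ, ENNReal.ofReal (Real.exp (t * S ω θ)) ∂Pbar := fun t =>
    (hem t).lintegral_prod_right'
  set W : Ω → ℝ≥0∞ := fun ω => ∫⁻ θ, ENNReal.ofReal (Real.exp (lam * S ω θ)) ∂Pbar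
    + ∫⁻ θ, ENNReal.ofReal (Real.exp (-lam * S ω θ)) ∂Pbar with hW
  have hWm : Measurable W := (hZm lam).add (hZm (-lam))
  have hapos : 0 < 2 / δ * E := by positivity
  have hmarkov : μ {ω | ENNReal.ofReal (2 / δ * E) ≤ W ω} ≤ ENNReal.ofReal δ := by
    refine (meas_ge_le_lintegral_div hWm.aemeasurable (by simpa using hapos)
      ENNReal.ofReal_ne_top).trans ?_
    refine ENNReal.div_le_of_le_mul ?_
    rw [hW, lintegral_add_left (hZm lam)]
    refine (add_le_add (hWle lam rfl) (hWle (-lam) (neg_sq lam))).trans_eq ?_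
    rw [← ENNReal.ofReal_add hEpos.le hEpos.le, ← ENNReal.ofReal_mul hδ0.le]
    congr 1
    field_simp
    ring
  have hgood : (1 : ℝ≥0∞) - ENNReal.ofReal δ ≤ μ {ω | W ω < ENNReal.ofReal (2 / δ * E)} := by
    have hcompl : {ω | W ω < ENNReal.ofReal (2 / δ * E)}
        = {ω | ENNReal.ofReal (2 / δ * E) ≤ W ω}ᶜ := by
      ext ω
      simp
    rw [hcompl, prob_compl_eq_one_sub (measurableSet_le measurable_const hWm)]
    exact tsub_le_tsub_left hmarkov 1
  have hSbdd : ∀ᵐ ω ∂μ, ∀ᵐ θ ∂Pbar, |S ω θ| ≤ T * c := by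
    refine (Measure.ae_ae_comm (p := fun ω θ => |S ω θ| ≤ T * c)
      (measurableSet_le hSm.abs measurable_const)).2 (ae_of_all _ fun θ => ?_)
    filter_upwards [(ae_ball_iff (Finset.countable_toSet (Finset.Icc 1 T))).2
      fun l hl => hbdd l hl θ] with ω hω
    refine (Finset.abs_sum_le_sum_abs _ _).trans ((Finset.sum_le_sum hω).trans_eq ?_)
    simp
  refine hgood.trans (measure_mono_ae ?_)
  filter_upwards [hSbdd] with ω hω (hWω : W ω < _)
  show ∀ P : Measure Θ, _
  intro P hP hkl
  have hSω : Measurable (S ω) := hSm.comp measurable_prodMk_left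
  have hside : ∀ t : ℝ, |t| = lam →
      ∫⁻ θ, ENNReal.ofReal (Real.exp (t * S ω θ)) ∂Pbar ≤ W ω →
      t * ∫ θ, S ω θ ∂P
        ≤ (klDiv P Pbar).toReal + Real.log (2 / δ) + T * ((lam * c) ^ 2 / 2) := by
    intro t ht htW
    have hb : ∀ᵐ θ ∂Pbar, |t * S ω θ| ≤ lam * (T * c) := by
      filter_upwards [hω] with θ hθ
      rw [abs_mul, ht]
      exact mul_le_mul_of_nonneg_left hθ hlam.le
    have hexp : Integrable (fun θ => Real.exp (t * S ω θ)) Pbar := by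
      refine Integrable.of_bound (hSω.const_mul t).exp.aestronglyMeasurable
        (Real.exp (lam * (T * c))) ?_
      filter_upwards [hb] with θ hθ
      rw [Real.norm_eq_abs, Real.abs_exp]
      exact Real.exp_le_exp.2 ((le_abs_self _).trans hθ)
    have hlt := htW.trans_lt hWω
    rw [← ofReal_integral_eq_lintegral_ofReal hexp (ae_of_all _ fun _ => (Real.exp_pos _).le),
      ENNReal.ofReal_lt_ofReal_iff hapos] at hlt
    have hlog := Real.log_le_log (integral_exp_pos hexp) hlt.le
    rw [Real.log_mul (by positivity) hEpos.ne', hE, Real.log_exp] at hlog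
    have hdv := integral_le_klDiv_add_log_integral_exp (P := P) (hSω.const_mul t) hb hkl
    rw [integral_const_mul] at hdv
    linarith
  have hpos := hside lam (abs_of_pos hlam) le_self_add
  have hneg := hside (-lam) (by rw [abs_neg, abs_of_pos hlam]) le_add_self
  have hrhs : ((klDiv P Pbar).toReal + Real.log (2 / δ)) / lam + lam * T * c ^ 2 / 2
      = ((klDiv P Pbar).toReal + Real.log (2 / δ) + T * ((lam * c) ^ 2 / 2)) / lam := by
    field_simp
  rw [hrhs, le_div_iff₀ hlam, ← abs_of_pos hlam, ← abs_mul, abs_of_pos hlam, abs_le']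
  constructor <;> linarith
end
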